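/- (Lemma 1, equality part.) With b = (k+1)/n, the prior adjusted default Bayes factor of the equality-constrained hypothesis H₁: R_E β = r_E against the unconstrained hypothesis equals a ratio of Student t densities: [m(r_E, 1)/m(R_E β̂, b)] / [m_u(1)/m_u(b)] = t(r_E; R_E β̂, s²(n−k)⁻¹ R_E(XᵀX)⁻¹R_Eᵀ, n−k) / t(r_E; r_E, s² R_E(XᵀX)⁻¹R_Eᵀ, 1), where m(ξ_E, c) = ∫_{ℝ^{k−q_E}} ∫₀^∞ (2πσ²)^{−nc/2} exp(−c‖y − X T⁻¹(ξ_E, ξ_I)‖²/(2σ²)) (σ²)⁻¹ dσ² dξ_I and m_u(c) = ∫_{ℝ^k} ∫₀^∞ (2πσ²)^{−nc/2} exp(−c‖y − Xβ‖²/(2σ²)) (σ²)⁻¹ dσ² dβ. -/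

import Mathlib

open Matrix MeasureTheory

/-- The multivariate Student `t` density. -/
noncomputable def studentT {d : ℕ} (ν : ℝ) (m : Fin d → ℝ)
    (S : Matrix (Fin d) (Fin d) ℝ) (x : Fin d → ℝ) : ℝ :=
  Real.Gamma ((ν + d) / 2) /
      (Real.Gamma (ν / 2) * (ν * Real.pi) ^ ((d : ℝ) / 2) * Real.sqrt S.det) *
    (1 + (x - m) ⬝ᵥ S⁻¹.mulVec (x - m) / ν) ^ (-(ν + d) / 2)

/-- The vector `(ξ_E, ξ_I) ∈ ℝ^{q_E} × ℝ^{k−q_E}` stacked into `ℝ^k`. -/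
def stackVec {k qE : ℕ} (hq : qE ≤ k) (ξE : Fin qE → ℝ) (ξI : Fin (k - qE) → ℝ) :
    Fin k → ℝ := fun i =>
  Sum.elim ξE ξI ((finSumFinEquiv.trans (finCongr (Nat.add_sub_cancel' hq))).symm i)

/-- The `k × k` matrix `T` obtained by stacking `R_E` on top of `D`. -/
def stackMat {k qE : ℕ} (hq : qE ≤ k) (RE : Matrix (Fin qE) (Fin k) ℝ)
    (D : Matrix (Fin (k - qE)) (Fin k) ℝ) : Matrix (Fin k) (Fin k) ℝ :=
  (Matrix.fromRows RE D).submatrix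
    (finSumFinEquiv.trans (finCongr (Nat.add_sub_cancel' hq))).symm id

/-- `∫₀^∞ (2πσ²)^{−nc/2} exp(−c·q/(2σ²)) (σ²)⁻¹ dσ²`,
where `q` is a residual sum of squares. -/
noncomputable def fracInt (n : ℕ) (c q : ℝ) : ℝ :=
  ∫ t in Set.Ioi (0 : ℝ),
    (2 * Real.pi * t) ^ (-((n : ℝ) * c) / 2) * Real.exp (-(c * q) / (2 * t)) * t⁻¹

/-- The OLS estimate `β̂ = (XᵀX)⁻¹Xᵀy`. -/
noncomputable def betaHat {n k : ℕ} (y : Fin n → ℝ) (X : Matrix (Fin n) (Fin k) ℝ) :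
    Fin k → ℝ := (Xᵀ * X)⁻¹.mulVec (Xᵀ.mulVec y)

/-- The sum of squares `s² = ‖y − Xβ̂‖²`. -/
noncomputable def sSq {n k : ℕ} (y : Fin n → ℝ) (X : Matrix (Fin n) (Fin k) ℝ) : ℝ :=
  (y - X.mulVec (betaHat y X)) ⬝ᵥ (y - X.mulVec (betaHat y X))

/-- Unconstrained fractional marginal likelihood `m_u(c)`. -/
noncomputable def mU {n k : ℕ} (y : Fin n → ℝ) (X : Matrix (Fin n) (Fin k) ℝ)
    (c : ℝ) : ℝ :=
  ∫ β : Fin k → ℝ, fracInt n c ((y - X.mulVec β) ⬝ᵥ (y - X.mulVec β))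

/-- Equality-constrained fractional marginal likelihood
`m(ξ_E, c) = ∫_{ℝ^{k−q_E}} ∫₀^∞ (2πσ²)^{−nc/2} exp(−c‖y − X T⁻¹(ξ_E,ξ_I)‖²/(2σ²))
  (σ²)⁻¹ dσ² dξ_I`. -/
noncomputable def mE {n k qE : ℕ} (hq : qE ≤ k) (y : Fin n → ℝ)
    (X : Matrix (Fin n) (Fin k) ℝ) (RE : Matrix (Fin qE) (Fin k) ℝ)
    (D : Matrix (Fin (k - qE)) (Fin k) ℝ) (ξE : Fin qE → ℝ) (c : ℝ) : ℝ :=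
  ∫ ξI : Fin (k - qE) → ℝ,
    fracInt n c
      ((y - X.mulVec ((stackMat hq RE D)⁻¹.mulVec (stackVec hq ξE ξI))) ⬝ᵥ
        (y - X.mulVec ((stackMat hq RE D)⁻¹.mulVec (stackVec hq ξE ξI))))

open Real in
/-- Inverse-gamma integral. -/
lemma fracInt_eq (n : ℕ) {c q : ℝ} (hn : 0 < (n : ℝ) * c) (hc : 0 < c) (hq : 0 < q) :
    fracInt n c q = Gamma (n * c / 2) * (π * c * q) ^ (-(n * c / 2)) := by
  set a : ℝ := n * c / 2 with ha
  have ha0 : 0 < a := by positivity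
  have hr : 0 < c * q / 2 := by positivity
  have hsub := integral_comp_rpow_Ioi
    (fun u : ℝ => (2 * π) ^ (-a) * (u ^ (a - 1) * exp (-(c * q / 2 * u)))) (p := -1) (by norm_num)
  rw [integral_const_mul, integral_rpow_mul_exp_neg_mul_Ioi ha0 hr] at hsub
  have hcongr : fracInt n c q = (2 * π) ^ (-a) * ((1 / (c * q / 2)) ^ a * Gamma a) := by
    rw [← hsub, fracInt]
    refine setIntegral_congr_fun measurableSet_Ioi fun t (ht : 0 < t) => ?_
    simp only [smul_eq_mul, rpow_neg_one, abs_neg, abs_one, one_mul]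
    rw [show -((n : ℝ) * c) / 2 = -a by rw [ha]; ring, mul_rpow (by positivity) ht.le,
      show -(c * q) / (2 * t) = -(c * q / 2 * t⁻¹) by field_simp,
      inv_rpow ht.le, ← rpow_neg ht.le]
    have hpow : t ^ (-a) * t⁻¹ = t ^ (-1 - 1 : ℝ) * t ^ (-(a - 1)) := by
      rw [← rpow_neg_one, ← rpow_add ht, ← rpow_add ht]
      congr 1
      ring
    linear_combination ((2 * π) ^ (-a) * exp (-(c * q / 2 * t⁻¹))) * hpow
  rw [hcongr, one_div, inv_rpow hr.le, ← rpow_neg hr.le, ← mul_assoc,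
    ← mul_rpow (by positivity) hr.le, mul_comm]
  congr 2
  ring

open Real in
lemma integral_exp_neg_mul_dotProduct_self {d : ℕ} {u : ℝ} (hu : 0 < u) :
    ∫ z : Fin d → ℝ, exp (-(u * (z ⬝ᵥ z))) = (π / u) ^ ((d : ℝ) / 2) := by
  have hprod (z : Fin d → ℝ) : exp (-(u * (z ⬝ᵥ z))) = ∏ i, exp (-u * z i ^ 2) := by
    rw [← exp_sum, dotProduct, Finset.mul_sum, ← Finset.sum_neg_distrib]
    congr 1
    exact Finset.sum_congr rfl fun i _ => by ring
  simp_rw [hprod]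
  rw [integral_fintype_prod_volume_eq_pow fun x : ℝ => exp (-u * x ^ 2), integral_gaussian,
    Fintype.card_fin, sqrt_eq_rpow, ← rpow_natCast, ← rpow_mul (by positivity)]
  congr 1
  ring

open Real in
lemma integrable_exp_neg_mul_dotProduct_self {d : ℕ} {u : ℝ} (hu : 0 < u) :
    Integrable fun z : Fin d → ℝ => exp (-(u * (z ⬝ᵥ z))) := by
  have h := Integrable.fintype_prod (ι := Fin d) (f := fun _ (x : ℝ) => exp (-u * x ^ 2))
    (μ := fun _ => volume) fun _ => integrable_exp_neg_mul_sq hu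
  refine h.congr (ae_of_all _ fun z => ?_)
  simp only
  rw [← exp_sum, dotProduct, Finset.mul_sum, ← Finset.sum_neg_distrib]
  congr 1
  exact Finset.sum_congr rfl fun i _ => by ring

open Real in
lemma integral_add_dotProduct_self_rpow {d : ℕ} {a Q : ℝ} (ha : (d : ℝ) / 2 < a) (hQ : 0 < Q) :
    ∫ z : Fin d → ℝ, (Q + z ⬝ᵥ z) ^ (-a) =
      π ^ ((d : ℝ) / 2) * Gamma (a - d / 2) / Gamma a * Q ^ ((d : ℝ) / 2 - a) := by
  have ha0 : 0 < a := lt_of_le_of_lt (by positivity) ha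
  have hG : 0 < Gamma a := Gamma_pos_of_pos ha0
  have hz (z : Fin d → ℝ) : 0 ≤ z ⬝ᵥ z := by simpa using dotProduct_star_self_nonneg z
  let f : (Fin d → ℝ) → ℝ → ℝ := fun z u => u ^ (a - 1) * exp (-((Q + z ⬝ᵥ z) * u))
  have hfac (z : Fin d → ℝ) (u : ℝ) :
      f z u = u ^ (a - 1) * exp (-(Q * u)) * exp (-(u * (z ⬝ᵥ z))) := by
    simp only [f]
    rw [mul_assoc, ← exp_add]
    congr 2
    ring
  have hinner (u : ℝ) (hu : 0 < u) :
      ∫ z, f z u = π ^ ((d : ℝ) / 2) * (u ^ (a - d / 2 - 1) * exp (-(Q * u))) := by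
    simp_rw [hfac]
    rw [integral_const_mul, integral_exp_neg_mul_dotProduct_self hu,
      div_rpow pi_pos.le hu.le, show a - d / 2 - 1 = (a - 1) - (d : ℝ) / 2 by ring,
      rpow_sub hu (a - 1)]
    ring
  have hint : Integrable (Function.uncurry f)
      ((volume : Measure (Fin d → ℝ)).prod (volume.restrict (Set.Ioi 0))) := by
    rw [integrable_prod_iff']
    · refine ⟨(ae_restrict_iff' measurableSet_Ioi).2 (ae_of_all _ fun u hu => ?_), ?_⟩
      · simp only [Function.uncurry, hfac]
        exact (integrable_exp_neg_mul_dotProduct_self hu).const_mul _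
      · have hg : IntegrableOn
            (fun u : ℝ => π ^ ((d : ℝ) / 2) * (u ^ (a - d / 2 - 1) * exp (-Q * u ^ (1 : ℝ))))
            (Set.Ioi 0) :=
          (integrableOn_rpow_mul_exp_neg_mul_rpow (by linarith) one_pos hQ).const_mul _
        refine hg.congr_fun (fun u (hu : 0 < u) => ?_) measurableSet_Ioi
        have hnorm (z : Fin d → ℝ) : ‖Function.uncurry f (z, u)‖ = f z u :=
          Real.norm_of_nonneg (mul_nonneg (rpow_nonneg hu.le _) (exp_pos _).le)
        simp only [hnorm, hinner u hu, rpow_one, neg_mul]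
    · have : Measurable (Function.uncurry f) := by
        simp only [f, Function.uncurry_def, dotProduct]
        fun_prop
      exact this.aestronglyMeasurable
  have hswap := integral_integral_swap hint
  have hleft (z : Fin d → ℝ) : ∫ u in Set.Ioi 0, f z u = Gamma a * (Q + z ⬝ᵥ z) ^ (-a) := by
    have hpos : 0 < Q + z ⬝ᵥ z := add_pos_of_pos_of_nonneg hQ (hz z)
    rw [integral_rpow_mul_exp_neg_mul_Ioi ha0 hpos, one_div, inv_rpow hpos.le,
      rpow_neg hpos.le, mul_comm]
  rw [setIntegral_congr_fun measurableSet_Ioi hinner, integral_const_mul,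
    integral_rpow_mul_exp_neg_mul_Ioi (by linarith) hQ] at hswap
  simp_rw [hleft] at hswap
  rw [integral_const_mul, one_div, inv_rpow hQ.le, ← rpow_neg hQ.le, neg_sub] at hswap
  rw [← mul_right_inj' hG.ne', hswap]
  field_simp

open scoped MatrixOrder ComplexOrder in
lemma Matrix.PosDef.exists_eq_transpose_mul_self {d : ℕ} {A : Matrix (Fin d) (Fin d) ℝ}
    (hA : A.PosDef) : ∃ B : Matrix (Fin d) (Fin d) ℝ, A = Bᵀ * B := by
  obtain ⟨B, hB⟩ := CStarAlgebra.nonneg_iff_eq_star_mul_self.mp hA.posSemidef.nonneg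
  exact ⟨B, by simpa [star_eq_conjTranspose] using hB⟩

open Real in
lemma integral_add_quadratic_rpow {d : ℕ} {A : Matrix (Fin d) (Fin d) ℝ} (hA : A.PosDef)
    (v : Fin d → ℝ) {a Q : ℝ} (ha : (d : ℝ) / 2 < a) (hQ : 0 < Q) :
    ∫ z : Fin d → ℝ, (Q + (z - v) ⬝ᵥ A *ᵥ (z - v)) ^ (-a) =
      (√A.det)⁻¹ * (π ^ ((d : ℝ) / 2) * Gamma (a - d / 2) / Gamma a * Q ^ ((d : ℝ) / 2 - a)) := by
  obtain ⟨B, rfl⟩ := hA.exists_eq_transpose_mul_self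
  have hdet : B.det ≠ 0 := by
    intro h
    simpa [h] using hA.det_pos
  rw [integral_sub_right_eq_self fun z : Fin d → ℝ => (Q + z ⬝ᵥ (Bᵀ * B) *ᵥ z) ^ (-a)]
  have hquad (z : Fin d → ℝ) : z ⬝ᵥ (Bᵀ * B) *ᵥ z = (toLin' B z) ⬝ᵥ (toLin' B z) := by
    rw [← mulVec_mulVec, dotProduct_mulVec, vecMul_transpose, toLin'_apply]
  simp_rw [hquad]
  have hmeas : Measurable (toLin' B) := (toLin' B).continuous_of_finiteDimensional.measurable
  have hf : Measurable fun w : Fin d → ℝ => (Q + w ⬝ᵥ w) ^ (-a) := by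
    simp only [dotProduct]
    fun_prop
  have hmap := integral_map (μ := volume) hmeas.aemeasurable
    (f := fun w : Fin d → ℝ => (Q + w ⬝ᵥ w) ^ (-a)) hf.aestronglyMeasurable
  rw [← hmap, Real.map_matrix_volume_pi_eq_smul_volume_pi hdet, integral_smul_measure,
    integral_add_dotProduct_self_rpow ha hQ, ENNReal.toReal_ofReal (abs_nonneg _), det_mul,
    det_transpose, sqrt_mul_self_eq_abs, abs_inv, smul_eq_mul]

open Real in
lemma integral_fracInt_add_quadratic {n d : ℕ} {A : Matrix (Fin d) (Fin d) ℝ} (hA : A.PosDef)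
    (v : Fin d → ℝ) {c Q : ℝ} (hc : 0 < c) (hd : (d : ℝ) < n * c) (hQ : 0 < Q) :
    ∫ z : Fin d → ℝ, fracInt n c (Q + (z - v) ⬝ᵥ A *ᵥ (z - v)) =
      (π * c) ^ (-(n * c / 2)) * (√A.det)⁻¹ * π ^ ((d : ℝ) / 2) *
        Gamma ((n * c - d) / 2) * Q ^ (-((n * c - d) / 2)) := by
  have hnc : 0 < (n : ℝ) * c := lt_of_le_of_lt (by positivity) hd
  have hG : 0 < Gamma ((n : ℝ) * c / 2) := Gamma_pos_of_pos (by positivity)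
  have hpoint (z : Fin d → ℝ) : fracInt n c (Q + (z - v) ⬝ᵥ A *ᵥ (z - v)) =
      Gamma (n * c / 2) * (π * c) ^ (-(n * c / 2)) *
        (Q + (z - v) ⬝ᵥ A *ᵥ (z - v)) ^ (-(n * c / 2)) := by
    have hnonneg : 0 ≤ (z - v) ⬝ᵥ A *ᵥ (z - v) := by
      simpa using hA.posSemidef.dotProduct_mulVec_nonneg (z - v)
    rw [fracInt_eq n hnc hc (by linarith), mul_rpow (by positivity) (by linarith), mul_assoc]
  simp_rw [hpoint]
  rw [integral_const_mul, integral_add_quadratic_rpow hA v (by linarith) hQ,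
    show (n : ℝ) * c / 2 - d / 2 = (n * c - d) / 2 by ring,
    show (d : ℝ) / 2 - n * c / 2 = -((n * c - d) / 2) by ring]
  field_simp

lemma residual_dotProduct_self {n k : ℕ} (y : Fin n → ℝ) (X : Matrix (Fin n) (Fin k) ℝ)
    (hX : IsUnit (Xᵀ * X)) (β : Fin k → ℝ) :
    (y - X *ᵥ β) ⬝ᵥ (y - X *ᵥ β) =
      sSq y X + (β - betaHat y X) ⬝ᵥ (Xᵀ * X) *ᵥ (β - betaHat y X) := by
  set δ := β - betaHat y X with hδ
  set r := y - X *ᵥ betaHat y X with hr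
  have horth : r ⬝ᵥ X *ᵥ δ = 0 := by
    have hnormal : Xᵀ *ᵥ r = 0 := by
      rw [hr, betaHat, mulVec_sub, mulVec_mulVec, mulVec_mulVec,
        mul_nonsing_inv _ ((isUnit_iff_isUnit_det _).1 hX), one_mulVec, sub_self]
    rw [dotProduct_mulVec, ← mulVec_transpose, hnormal, zero_dotProduct]
  have hres : y - X *ᵥ β = r - X *ᵥ δ := by
    rw [hr, hδ, mulVec_sub]
    abel
  have hquad : δ ⬝ᵥ (Xᵀ * X) *ᵥ δ = X *ᵥ δ ⬝ᵥ X *ᵥ δ := by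
    rw [← mulVec_mulVec, dotProduct_mulVec, vecMul_transpose]
  rw [hres, hquad, sSq, ← hr, sub_dotProduct, dotProduct_sub r, dotProduct_sub (X *ᵥ δ),
    dotProduct_comm (X *ᵥ δ) r, horth]
  ring

lemma stackMat_mulVec {k qE : ℕ} (hq : qE ≤ k) (RE : Matrix (Fin qE) (Fin k) ℝ)
    (D : Matrix (Fin (k - qE)) (Fin k) ℝ) (x : Fin k → ℝ) :
    stackMat hq RE D *ᵥ x = stackVec hq (RE *ᵥ x) (D *ᵥ x) := by
  ext i
  change (fromRows RE D *ᵥ x) _ = _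
  rw [fromRows_mulVec, stackVec]

lemma exists_stackVec_eq {k qE : ℕ} (hq : qE ≤ k) (t : Fin k → ℝ) :
    ∃ ξE ξI, stackVec hq ξE ξI = t := by
  let e := finSumFinEquiv.trans (finCongr (Nat.add_sub_cancel' hq))
  refine ⟨fun i => t (e (.inl i)), fun i => t (e (.inr i)), funext fun i => ?_⟩
  obtain ⟨j, rfl⟩ := e.surjective i
  change Sum.elim _ _ (e.symm (e j)) = _
  rw [e.symm_apply_apply]
  cases j <;> rfl

lemma Matrix.isUnit_mul_transpose_of_rank_eq {p k : ℕ} {R : Matrix (Fin p) (Fin k) ℝ}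
    (hR : R.rank = p) : IsUnit (R * Rᵀ) := by
  refine mulVec_surjective_iff_isUnit.1 ?_
  have h : (R * Rᵀ).rank = p := by rw [rank_self_mul_transpose, hR]
  rw [← coe_mulVecLin, ← LinearMap.range_eq_top]
  exact Submodule.eq_top_of_finrank_eq (by simpa [rank] using h)

lemma Matrix.vecMul_injective_of_rank_eq {p k : ℕ} {R : Matrix (Fin p) (Fin k) ℝ}
    (hR : R.rank = p) : Function.Injective R.vecMul := by
  have h := isUnit_mul_transpose_of_rank_eq hR
  refine Function.LeftInverse.injective (g := fun w => w ᵥ* (Rᵀ * (R * Rᵀ)⁻¹)) fun v => ?_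
  simp only [vecMul_vecMul]
  rw [← Matrix.mul_assoc, mul_nonsing_inv _ ((isUnit_iff_isUnit_det _).1 h), vecMul_one]

lemma posDef_mul_inv_mul_transpose {p k : ℕ} {G : Matrix (Fin k) (Fin k) ℝ} (hG : G.PosDef)
    {R : Matrix (Fin p) (Fin k) ℝ} (hR : R.rank = p) : (R * G⁻¹ * Rᵀ).PosDef := by
  simpa using hG.inv.mul_mul_conjTranspose_same (vecMul_injective_of_rank_eq hR)

/-- The inverse of the stacked matrix, when its two blocks are orthogonal. -/
lemma stackMat_inv_mulVec {k qE : ℕ} (hq : qE ≤ k) {RE : Matrix (Fin qE) (Fin k) ℝ}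
    {D : Matrix (Fin (k - qE)) (Fin k) ℝ} (hRE : RE.rank = qE) (hD : D.rank = k - qE)
    (hDRE : D * REᵀ = 0) (x : Fin k → ℝ) :
    (stackMat hq RE D)⁻¹ *ᵥ stackVec hq (RE *ᵥ x) (D *ᵥ x) = x := by
  have hunit : IsUnit (stackMat hq RE D) := by
    refine mulVec_surjective_iff_isUnit.1 fun t => ?_
    obtain ⟨ξE, ξI, rfl⟩ := exists_stackVec_eq hq t
    have hRR := (isUnit_iff_isUnit_det _).1 (isUnit_mul_transpose_of_rank_eq hRE)
    have hDD := (isUnit_iff_isUnit_det _).1 (isUnit_mul_transpose_of_rank_eq hD)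
    have hRED : RE * Dᵀ = 0 := by simpa using congrArg transpose hDRE
    refine ⟨(REᵀ * (RE * REᵀ)⁻¹) *ᵥ ξE + (Dᵀ * (D * Dᵀ)⁻¹) *ᵥ ξI, ?_⟩
    rw [stackMat_mulVec]
    simp [mulVec_add, mulVec_mulVec, ← Matrix.mul_assoc, hRED, hDRE,
      mul_nonsing_inv _ hRR, mul_nonsing_inv _ hDD]
  rw [← stackMat_mulVec, mulVec_mulVec,
    nonsing_inv_mul _ ((isUnit_iff_isUnit_det _).1 hunit), one_mulVec]

/-- Profiling out the unconstrained coordinates splits the quadratic form of `G` into the quadratic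
form of `(R G⁻¹ Rᵀ)⁻¹` in the constrained ones and a positive definite remainder. -/
lemma exists_stackMat_quadratic_eq {k qE : ℕ} (hq : qE ≤ k) {RE : Matrix (Fin qE) (Fin k) ℝ}
    {D : Matrix (Fin (k - qE)) (Fin k) ℝ} (hRE : RE.rank = qE) (hD : D.rank = k - qE)
    (hDRE : D * REᵀ = 0) {G : Matrix (Fin k) (Fin k) ℝ} (hG : G.PosDef) (μ : Fin k → ℝ) :
    ∃ A : Matrix (Fin (k - qE)) (Fin (k - qE)) ℝ, A.PosDef ∧ ∀ ξE, ∃ v, ∀ ξI,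
      ((stackMat hq RE D)⁻¹ *ᵥ stackVec hq ξE ξI - μ) ⬝ᵥ
          G *ᵥ ((stackMat hq RE D)⁻¹ *ᵥ stackVec hq ξE ξI - μ) =
        (ξE - RE *ᵥ μ) ⬝ᵥ (RE * G⁻¹ * REᵀ)⁻¹ *ᵥ (ξE - RE *ᵥ μ) +
          (ξI - v) ⬝ᵥ A *ᵥ (ξI - v) := by
  set V := RE * G⁻¹ * REᵀ with hV
  have hVpos : V.PosDef := posDef_mul_inv_mul_transpose hG hRE
  have hVdet : IsUnit V.det := (isUnit_iff_isUnit_det _).1 hVpos.isUnit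
  have hGdet : IsUnit G.det := (isUnit_iff_isUnit_det _).1 hG.isUnit
  have hDD := (isUnit_iff_isUnit_det _).1 (isUnit_mul_transpose_of_rank_eq hD)
  set N := Dᵀ * (D * Dᵀ)⁻¹ with hN
  have hDN : D * N = 1 := by rw [hN, ← Matrix.mul_assoc, mul_nonsing_inv _ hDD]
  have hRN : RE * N = 0 := by
    have : RE * Dᵀ = 0 := by simpa using congrArg transpose hDRE
    rw [hN, ← Matrix.mul_assoc, this, Matrix.zero_mul]
  have hNinj : Function.Injective N.mulVec :=
    Function.LeftInverse.injective (g := D.mulVec) fun z => by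
      rw [mulVec_mulVec, hDN, one_mulVec]
  refine ⟨Nᵀ * G * N, by simpa using hG.conjTranspose_mul_mul_same hNinj, fun ξE => ?_⟩
  set δ := ξE - RE *ᵥ μ with hδ
  set w := (G⁻¹ * REᵀ * V⁻¹) *ᵥ δ with hw
  have hRw : RE *ᵥ w = δ := by
    rw [hw, mulVec_mulVec, ← Matrix.mul_assoc, ← Matrix.mul_assoc, ← hV, mul_nonsing_inv _ hVdet,
      one_mulVec]
  have hGw : G *ᵥ w = REᵀ *ᵥ V⁻¹ *ᵥ δ := by
    rw [hw, mulVec_mulVec, mulVec_mulVec, ← Matrix.mul_assoc, ← Matrix.mul_assoc,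
      mul_nonsing_inv _ hGdet, Matrix.one_mul]
  refine ⟨D *ᵥ (μ + w), fun ξI => ?_⟩
  set ζ := ξI - D *ᵥ (μ + w) with hζ
  have hR : RE *ᵥ (μ + w + N *ᵥ ζ) = ξE := by
    rw [mulVec_add, mulVec_add, hRw, mulVec_mulVec, hRN, zero_mulVec, hδ]
    abel
  have hDx : D *ᵥ (μ + w + N *ᵥ ζ) = ξI := by
    rw [mulVec_add, mulVec_mulVec, hDN, one_mulVec, hζ]
    abel
  have hx := stackMat_inv_mulVec hq hRE hD hDRE (μ + w + N *ᵥ ζ)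
  rw [hR, hDx] at hx
  rw [hx, show μ + w + N *ᵥ ζ - μ = w + N *ᵥ ζ by abel]
  have hcross : N *ᵥ ζ ⬝ᵥ G *ᵥ w = 0 := by
    rw [hGw, dotProduct_mulVec, vecMul_transpose, mulVec_mulVec, hRN, zero_mulVec,
      zero_dotProduct]
  have hcross' : w ⬝ᵥ G *ᵥ (N *ᵥ ζ) = 0 := by
    have hGt : Gᵀ = G := by simpa using hG.isHermitian.eq
    rw [dotProduct_mulVec, ← mulVec_transpose, hGt, dotProduct_comm, hcross]
  have hww : w ⬝ᵥ G *ᵥ w = δ ⬝ᵥ V⁻¹ *ᵥ δ := by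
    rw [hGw, dotProduct_mulVec, vecMul_transpose, hRw]
  have hNN : N *ᵥ ζ ⬝ᵥ G *ᵥ (N *ᵥ ζ) = ζ ⬝ᵥ (Nᵀ * G * N) *ᵥ ζ := by
    rw [Matrix.mul_assoc, ← mulVec_mulVec ζ Nᵀ, ← mulVec_mulVec ζ G, dotProduct_mulVec ζ,
      vecMul_transpose]
  rw [mulVec_add, dotProduct_add, add_dotProduct, add_dotProduct, hcross, hcross', hww, hNN]
  ring

lemma posDef_transpose_mul_self_of_isUnit {n k : ℕ} {X : Matrix (Fin n) (Fin k) ℝ}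
    (hX : IsUnit (Xᵀ * X)) : (Xᵀ * X).PosDef := by
  have h : (Xᵀ * X).PosSemidef := by simpa using posSemidef_conjTranspose_mul_self X
  exact h.posDef_iff_isUnit.2 hX

open Real in
lemma mU_eq {n k : ℕ} {y : Fin n → ℝ} {X : Matrix (Fin n) (Fin k) ℝ} (hX : IsUnit (Xᵀ * X))
    (hs2 : 0 < sSq y X) {c : ℝ} (hc : 0 < c) (hk : (k : ℝ) < n * c) :
    mU y X c = (π * c) ^ (-(n * c / 2)) * (√(Xᵀ * X).det)⁻¹ * π ^ ((k : ℝ) / 2) *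
      Gamma ((n * c - k) / 2) * sSq y X ^ (-((n * c - k) / 2)) := by
  rw [mU, ← integral_fracInt_add_quadratic (posDef_transpose_mul_self_of_isUnit hX)
    (betaHat y X) hc hk hs2]
  simp_rw [residual_dotProduct_self y X hX]

open Real in
/-- The constrained marginal likelihood, up to the determinant of a matrix that depends on neither
`ξE` nor `c`. -/
lemma exists_mE_eq {n k qE : ℕ} (hq : qE ≤ k) {y : Fin n → ℝ} {X : Matrix (Fin n) (Fin k) ℝ}
    (hX : IsUnit (Xᵀ * X)) {RE : Matrix (Fin qE) (Fin k) ℝ}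
    {D : Matrix (Fin (k - qE)) (Fin k) ℝ} (hRE : RE.rank = qE) (hD : D.rank = k - qE)
    (hDRE : D * REᵀ = 0) (hs2 : 0 < sSq y X) :
    ∃ δ > 0, ∀ ξE c, 0 < c → (k : ℝ) < n * c →
      mE hq y X RE D ξE c = (π * c) ^ (-(n * c / 2)) * δ * π ^ (((k : ℝ) - qE) / 2) *
        Gamma ((n * c - k + qE) / 2) *
        (sSq y X + (ξE - RE *ᵥ betaHat y X) ⬝ᵥ
          (RE * (Xᵀ * X)⁻¹ * REᵀ)⁻¹ *ᵥ (ξE - RE *ᵥ betaHat y X)) ^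
            (-((n * c - k + qE) / 2)) := by
  have hG := posDef_transpose_mul_self_of_isUnit hX
  obtain ⟨A, hA, hquad⟩ := exists_stackMat_quadratic_eq hq hRE hD hDRE hG (betaHat y X)
  have hV := (posDef_mul_inv_mul_transpose hG hRE).inv.posSemidef
  refine ⟨(√A.det)⁻¹, inv_pos.2 (sqrt_pos.2 hA.det_pos), fun ξE c hc hk => ?_⟩
  obtain ⟨v, hv⟩ := hquad ξE
  have hQ : 0 < sSq y X + (ξE - RE *ᵥ betaHat y X) ⬝ᵥ
      (RE * (Xᵀ * X)⁻¹ * REᵀ)⁻¹ *ᵥ (ξE - RE *ᵥ betaHat y X) :=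
    add_pos_of_pos_of_nonneg hs2 (hV.dotProduct_mulVec_nonneg (ξE - RE *ᵥ betaHat y X))
  have hd : ((k - qE : ℕ) : ℝ) = k - qE := Nat.cast_sub hq
  have hqE : (0 : ℝ) ≤ qE := qE.cast_nonneg
  have h := integral_fracInt_add_quadratic (n := n) hA v hc (by rw [hd]; linarith) hQ
  rw [hd, sub_sub_eq_add_sub, add_sub_right_comm] at h
  rw [mE, ← h]
  simp_rw [residual_dotProduct_self y X hX, hv, add_assoc]

open Real in
lemma studentT_smul {d : ℕ} {ν s : ℝ} (hν : 0 < ν) (hs : 0 < s) (m x : Fin d → ℝ)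
    {V : Matrix (Fin d) (Fin d) ℝ} (hV : V.PosDef) :
    studentT ν m ((s / ν) • V) x =
      Gamma ((ν + d) / 2) / (Gamma (ν / 2) * π ^ ((d : ℝ) / 2) * √V.det) *
        (s ^ (ν / 2) * (s + (x - m) ⬝ᵥ V⁻¹ *ᵥ (x - m)) ^ (-((ν + d) / 2))) := by
  have hVdet : IsUnit V.det := (isUnit_iff_isUnit_det _).1 hV.isUnit
  have hquad : 0 ≤ (x - m) ⬝ᵥ V⁻¹ *ᵥ (x - m) := by
    simpa using hV.inv.posSemidef.dotProduct_mulVec_nonneg (x - m)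
  set q := (x - m) ⬝ᵥ V⁻¹ *ᵥ (x - m) with hq
  have hsν : 0 < s / ν := div_pos hs hν
  have hinv : ((s / ν) • V)⁻¹ = (ν / s) • V⁻¹ := by
    refine inv_eq_right_inv ?_
    rw [smul_mul_smul_comm, mul_nonsing_inv _ hVdet, div_mul_div_cancel₀ hν.ne', div_self hs.ne',
      one_smul]
  have hbase : 1 + (x - m) ⬝ᵥ ((s / ν) • V)⁻¹ *ᵥ (x - m) / ν = (s + q) / s := by
    rw [hinv, smul_mulVec, dotProduct_smul, ← hq, smul_eq_mul]
    field_simp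
  have hdet : √((s / ν) • V).det = (s / ν) ^ ((d : ℝ) / 2) * √V.det := by
    rw [det_smul, Fintype.card_fin, sqrt_mul (by positivity), sqrt_eq_rpow ((s / ν) ^ d),
      ← rpow_natCast, ← rpow_mul hsν.le, mul_one_div]
  have hscale : (ν * π) ^ ((d : ℝ) / 2) * (s / ν) ^ ((d : ℝ) / 2) =
      π ^ ((d : ℝ) / 2) * s ^ ((d : ℝ) / 2) := by
    rw [← mul_rpow (by positivity) hsν.le, ← mul_rpow pi_pos.le hs.le]
    congr 1
    field_simp
  have hpow : ((s + q) / s) ^ (-(ν + d) / 2) =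
      s ^ ((d : ℝ) / 2) * (s ^ (ν / 2) * (s + q) ^ (-((ν + d) / 2))) := by
    rw [neg_div, div_rpow (by linarith) hs.le, rpow_neg hs.le, div_inv_eq_mul, ← mul_assoc,
      ← rpow_add hs, mul_comm]
    congr 2
    ring
  rw [studentT, hbase, hpow, hdet,
    show Gamma (ν / 2) * (ν * π) ^ ((d : ℝ) / 2) * ((s / ν) ^ ((d : ℝ) / 2) * √V.det) =
      Gamma (ν / 2) * π ^ ((d : ℝ) / 2) * √V.det * s ^ ((d : ℝ) / 2) by
        linear_combination (Gamma (ν / 2) * √V.det) * hscale]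
  have : 0 < s ^ ((d : ℝ) / 2) := rpow_pos_of_pos hs _
  field_simp

/-- **Lemma 1, equality part.** With `b = (k+1)/n`, the prior adjusted
default Bayes factor of `H₁ : R_E β = r_E` against the unconstrained hypothesis equals
`t(r_E; R_E β̂, s²(n−k)⁻¹ R_E(XᵀX)⁻¹R_Eᵀ, n−k) / t(r_E; r_E, s² R_E(XᵀX)⁻¹R_Eᵀ, 1)`. -/
theorem stmt_11 {n k qE : ℕ} (hnk : k < n) (hq : qE ≤ k)
    (y : Fin n → ℝ) (X : Matrix (Fin n) (Fin k) ℝ) (hX : IsUnit (Xᵀ * X))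
    (RE : Matrix (Fin qE) (Fin k) ℝ) (rE : Fin qE → ℝ)
    (D : Matrix (Fin (k - qE)) (Fin k) ℝ)
    (hRE : RE.rank = qE) (hD : D.rank = k - qE) (hDRE : D * REᵀ = 0)
    (hs2 : 0 < sSq y X) :
    let b : ℝ := ((k : ℝ) + 1) / n
    (mE hq y X RE D rE 1 / mE hq y X RE D (RE.mulVec (betaHat y X)) b) /
        (mU y X 1 / mU y X b) =
      studentT ((n : ℝ) - k) (RE.mulVec (betaHat y X))
          ((sSq y X / ((n : ℝ) - k)) • (RE * (Xᵀ * X)⁻¹ * REᵀ)) rE /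
        studentT 1 rE (sSq y X • (RE * (Xᵀ * X)⁻¹ * REᵀ)) rE := by
  intro b
  have hnk' : (k : ℝ) < n := by exact_mod_cast hnk
  have hk : (0 : ℝ) ≤ k := k.cast_nonneg
  have hn : (0 : ℝ) < n := by linarith
  have hb : 0 < b := by positivity
  have hnb : (n : ℝ) * b = k + 1 := mul_div_cancel₀ _ hn.ne'
  have hν : 0 < (n : ℝ) - k := sub_pos.2 hnk'
  have hV := posDef_mul_inv_mul_transpose (posDef_transpose_mul_self_of_isUnit hX) hRE
  obtain ⟨δ, hδ, hmE⟩ := exists_mE_eq hq hX hRE hD hDRE hs2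
  have hT1 := studentT_smul (d := qE) one_pos hs2 rE rE hV
  rw [div_one] at hT1
  rw [hmE _ _ one_pos (by linarith), hmE _ _ hb (by linarith), mU_eq hX hs2 one_pos (by linarith),
    mU_eq hX hs2 hb (by linarith), studentT_smul hν hs2 _ _ hV, hT1, hnb]
  simp only [sub_self, zero_dotProduct, add_zero, mul_one, add_sub_cancel_left]
  have hG := (posDef_transpose_mul_self_of_isUnit hX).det_pos
  have hVdet := hV.det_pos
  rw [Real.rpow_neg hs2.le (((n : ℝ) - k) / 2), Real.rpow_neg hs2.le (1 / 2)]
  field_simp
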